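/- (The Pascal line for cubics) Let A, B, C, D, E, F be six distinct points of ℙ²(ℂ) lying on an irreducible conic 𝒞. Let 𝒟₁ and 𝒟₂ be two cubics, given by homogeneous degree-3 polynomials with no common nonconstant factor, each passing through A, B, C, D, E, F, and suppose their common zero set consists of exactly nine distinct points: the six given points together with three further points P, Q, R. Then P, Q and R are collinear. -/

import Mathlib

open MvPolynomial

noncomputable section

/-- Polynomials in three variables over `ℂ`. -/
abbrev Poly3 : Type := MvPolynomial (Fin 3) ℂ

/-- The complex projective plane `ℙ²(ℂ)`, the projectivization of `ℂ³`. -/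
abbrev ProjPlane : Type := Projectivization ℂ (Fin 3 → ℂ)

/-- A (homogeneous) polynomial vanishes at a projective point if it vanishes at its
canonical nonzero representative vector (for homogeneous polynomials this is equivalent
to vanishing at any nonzero representative vector). -/
def VanishesAt (F : Poly3) (p : ProjPlane) : Prop :=
  MvPolynomial.eval p.rep F = 0

/-- The set of points of `ℙ²(ℂ)` at which `F` vanishes. -/
def zeroSet (F : Poly3) : Set ProjPlane := {p | VanishesAt F p}

/-- Two defining polynomials give the same curve iff they are proportional by a
nonzero scalar. -/
def ProportionalTo (F G : Poly3) : Prop := ∃ c : ℂ, c ≠ 0 ∧ G = c • F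

/-- A set of points is collinear if some nonzero homogeneous polynomial of degree 1
vanishes at all of them. -/
def Collin (s : Set ProjPlane) : Prop :=
  ∃ L : Poly3, L ≠ 0 ∧ L.IsHomogeneous 1 ∧ ∀ p ∈ s, VanishesAt L p

/-- No three distinct points of `s` are collinear. -/
def NoThreeCollinear (s : Set ProjPlane) : Prop :=
  ∀ p q r, p ∈ s → q ∈ s → r ∈ s → p ≠ q → p ≠ r → q ≠ r → ¬ Collin {p, q, r}

/-- `L` is a (the) line through the points `p` and `q`. -/
def IsLineThrough (L : Poly3) (p q : ProjPlane) : Prop :=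
  L ≠ 0 ∧ L.IsHomogeneous 1 ∧ VanishesAt L p ∧ VanishesAt L q

/-- `L` is the generalized Pascal line of the cubics `D₁` and `D₂` with respect to six
points `A, …, F`: the cubics have no common nonconstant factor, their common zero set
consists of exactly nine distinct points (the six given ones plus three further points),
and `L` is the line through the three further intersection points. -/
def IsGenPascalLine (A B C D E F : ProjPlane) (D₁ D₂ L : Poly3) : Prop :=
  IsRelPrime D₁ D₂ ∧ L ≠ 0 ∧ L.IsHomogeneous 1 ∧
    ∃ P Q R : ProjPlane,
      ([A, B, C, D, E, F, P, Q, R] : List ProjPlane).Pairwise (· ≠ ·) ∧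
      zeroSet D₁ ∩ zeroSet D₂ = {A, B, C, D, E, F, P, Q, R} ∧
      VanishesAt L P ∧ VanishesAt L Q ∧ VanishesAt L R

/-- A linear form, evaluated at a linear combination of three vectors. -/
lemma MvPolynomial.IsHomogeneous.eval_linear_comb {L : Poly3} (hL : L.IsHomogeneous 1)
    (u v w : Fin 3 → ℂ) (r s t : ℂ) :
    eval (r • u + s • v + t • w) L = r * eval u L + s * eval v L + t * eval w L := by
  have hmem : L ∈ Submodule.span ℂ (Set.range (X : Fin 3 → Poly3)) := by
    rwa [← homogeneousSubmodule_one_eq_span_X]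
  induction hmem using Submodule.span_induction with
  | mem x hx => obtain ⟨i, rfl⟩ := hx; simp
  | zero => simp
  | add x y hx hy ihx ihy =>
    rw [← homogeneousSubmodule_one_eq_span_X] at hx hy
    simp only [map_add, ihx hx, ihy hy]; ring
  | smul a x hx ihx =>
    rw [← homogeneousSubmodule_one_eq_span_X] at hx
    simp only [smul_eval, ihx hx]; ring

/-- The polar form of a polynomial, as a function. -/
def polarForm (K : Poly3) (u v : Fin 3 → ℂ) : ℂ := eval (u + v) K - eval u K - eval v K

/-- A quadratic form, evaluated at a linear combination of three vectors. -/
lemma MvPolynomial.IsHomogeneous.eval_quadratic_comb {K : Poly3} (hK : K.IsHomogeneous 2)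
    (u v w : Fin 3 → ℂ) (r s t : ℂ) :
    eval (r • u + s • v + t • w) K =
      r ^ 2 * eval u K + s ^ 2 * eval v K + t ^ 2 * eval w K + r * s * polarForm K u v
        + r * t * polarForm K u w + s * t * polarForm K v w := by
  have hmem : K ∈ homogeneousSubmodule (Fin 3) ℂ 1 * homogeneousSubmodule (Fin 3) ℂ 1 := by
    rwa [← pow_two, homogeneousSubmodule_one_pow]
  clear hK
  induction hmem using Submodule.mul_induction_on' with
  | mem_mul_mem a ha b hb =>
    have hadd : ∀ {L : Poly3}, L.IsHomogeneous 1 → ∀ x y : Fin 3 → ℂ,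
        eval (x + y) L = eval x L + eval y L := fun hL x y => by
      simpa using hL.eval_linear_comb x y 0 1 1 0
    have hsmul : ∀ {L : Poly3}, L.IsHomogeneous 1 → ∀ (c : ℂ) (x : Fin 3 → ℂ),
        eval (c • x) L = c * eval x L := fun hL c x => by
      simpa using hL.eval_linear_comb x 0 0 c 0 0
    simp only [polarForm, map_mul, hadd ha, hadd hb, hsmul ha, hsmul hb]
    ring
  | add x hx y hy ihx ihy =>
    simp only [map_add, ihx, ihy, polarForm]; ring

/-- The linear form with given coefficients. -/
def linearForm (l : Fin 3 → ℂ) : Poly3 := Fintype.linearCombination ℂ (X : Fin 3 → Poly3) l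

@[simp]
lemma eval_linearForm (l x : Fin 3 → ℂ) : eval x (linearForm l) = l ⬝ᵥ x := by
  simp [linearForm, Fintype.linearCombination_apply, dotProduct, smul_eval]

lemma isHomogeneous_linearForm (l : Fin 3 → ℂ) : (linearForm l).IsHomogeneous 1 := by
  rw [← mem_homogeneousSubmodule, homogeneousSubmodule_one_eq_span_X, linearForm,
    ← Fintype.range_linearCombination]
  exact LinearMap.mem_range_self _ _

lemma linearForm_eq_zero {l : Fin 3 → ℂ} (h : linearForm l = 0) : l = 0 := by
  funext i
  simpa [h] using (eval_linearForm l (Pi.single i 1)).symm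

lemma MvPolynomial.IsHomogeneous.not_isUnit {F : Poly3} {n : ℕ} (hF : F.IsHomogeneous n)
    (hn : n ≠ 0) : ¬ IsUnit F := fun h => by
  have := h.map (eval (0 : Fin 3 → ℂ))
  rw [eval_zero, constantCoeff_eq, hF.coeff_eq_zero (by simpa using hn.symm)] at this
  simp at this

open Matrix in
/-- An irreducible conic does not contain a line. -/
lemma polarForm_ne_zero_of_irreducible {K : Poly3} (hK : K.IsHomogeneous 2) (hirr : Irreducible K)
    {u v : Fin 3 → ℂ} (huv : LinearIndependent ℂ ![u, v]) (hu : eval u K = 0)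
    (hv : eval v K = 0) : polarForm K u v ≠ 0 := by
  intro hpol
  obtain ⟨i, hi⟩ := Function.ne_iff.1 (crossProduct_ne_zero_iff_linearIndependent.2 huv)
  obtain ⟨w, hw⟩ : ∃ w, u ⨯₃ v ⬝ᵥ w ≠ 0 := ⟨Pi.single i 1, by simpa using hi⟩
  set δ := u ⨯₃ v ⬝ᵥ w with hδ
  have hcomb : ∀ x : Fin 3 → ℂ,
      x = (δ⁻¹ * (v ⨯₃ w ⬝ᵥ x)) • u + (δ⁻¹ * (w ⨯₃ u ⬝ᵥ x)) • v
        + (δ⁻¹ * (u ⨯₃ v ⬝ᵥ x)) • w := by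
    intro x
    have : δ • x = (v ⨯₃ w ⬝ᵥ x) • u + (w ⨯₃ u ⬝ᵥ x) • v + (u ⨯₃ v ⬝ᵥ x) • w := by
      funext j
      fin_cases j <;>
        simp [hδ, cross_apply, dotProduct, Fin.sum_univ_three] <;> ring
    rw [mul_smul, mul_smul, mul_smul, ← smul_add, ← smul_add, ← this, inv_smul_smul₀ hw]
  have hfac : K = linearForm (δ⁻¹ • (u ⨯₃ v)) *
      linearForm ((δ⁻¹ * polarForm K u w) • (v ⨯₃ w) + (δ⁻¹ * polarForm K v w) • (w ⨯₃ u)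
        + (δ⁻¹ * eval w K) • (u ⨯₃ v)) := by
    refine MvPolynomial.funext fun x => ?_
    conv_lhs => rw [hcomb x]
    rw [hK.eval_quadratic_comb, hu, hv, hpol]
    simp only [map_mul, eval_linearForm, smul_dotProduct, add_dotProduct, smul_eq_mul]
    ring
  rw [hfac] at hirr
  rcases hirr.isUnit_or_isUnit rfl with h | h
  · exact (isHomogeneous_linearForm _).not_isUnit one_ne_zero h
  · exact (isHomogeneous_linearForm _).not_isUnit one_ne_zero h

open Matrix in
/-- No three distinct points of an irreducible conic are collinear. -/
lemma triple_product_ne_zero_of_irreducible {K : Poly3} (hK : K.IsHomogeneous 2)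
    (hirr : Irreducible K) {u v w : Fin 3 → ℂ} (huv : LinearIndependent ℂ ![u, v])
    (huw : LinearIndependent ℂ ![u, w]) (hvw : LinearIndependent ℂ ![v, w])
    (hu : eval u K = 0) (hv : eval v K = 0) (hw : eval w K = 0) : u ⨯₃ v ⬝ᵥ w ≠ 0 := by
  intro h
  have hdet : Matrix.det ![u, v, w] = 0 := by
    rw [← triple_product_eq_det, triple_product_permutation, triple_product_permutation,
      dotProduct_comm, h]
  obtain ⟨c, hc, hc0⟩ := Matrix.exists_vecMul_eq_zero_iff.2 hdet
  have hsum : c 0 • u + c 1 • v + c 2 • w = 0 := by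
    rw [← hc0]
    funext j
    simp [Matrix.vecMul, dotProduct, Fin.sum_univ_three]
  have hpol := polarForm_ne_zero_of_irreducible hK hirr huv hu hv
  have hc01 : c 0 * c 1 = 0 := by
    have h2 : c 0 • u + c 1 • v + (0 : ℂ) • w = (0 : ℂ) • u + (0 : ℂ) • v + (-c 2) • w := by
      rw [zero_smul, zero_smul, zero_smul, neg_smul, add_zero, zero_add, zero_add]
      exact eq_neg_of_add_eq_zero_left hsum
    have h3 := congrArg (fun x => eval x K) h2
    simp only [hK.eval_quadratic_comb, hu, hv, hw] at h3
    have h4 : c 0 * c 1 * polarForm K u v = 0 := by linear_combination h3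
    exact (mul_eq_zero.1 h4).resolve_right hpol
  rw [LinearIndependent.pair_iff] at huv huw hvw
  refine hc (funext fun j => ?_)
  rcases mul_eq_zero.1 hc01 with h0 | h1
  · obtain ⟨h1, h2⟩ := hvw (c 1) (c 2) (by simpa [h0] using hsum)
    fin_cases j <;> assumption
  · obtain ⟨h0, h2⟩ := huw (c 0) (c 2) (by simpa [h1] using hsum)
    fin_cases j <;> assumption

lemma finrank_homogeneousSubmodule (n : ℕ) :
    Module.finrank ℂ (homogeneousSubmodule (Fin 3) ℂ n) = (n + 2).choose 2 := by
  have hset : {d : Fin 3 →₀ ℕ | d.degree = n}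
      = ((Finset.univ : Finset (Fin 3)).finsuppAntidiag n : Set (Fin 3 →₀ ℕ)) := by
    ext d
    simp [Finsupp.degree_eq_sum]
  rw [homogeneousSubmodule_eq_finsupp_supported, hset,
    (AddMonoidAlgebra.supportedEquivFinsupp _).finrank_eq, Module.finrank_finsupp_self]
  simp only [Finset.coe_sort_coe, Fintype.card_coe, Finset.card_finsuppAntidiag_nat_eq_choose]
  rw [Finset.card_univ, Fintype.card_fin, show 3 + n - 1 = n + 2 by omega, Nat.choose_symm_add]

/-- If cubic forms separate `m` points of a conic, then among more than `7 - m` cubics through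
these points some nontrivial linear combination is divisible by the equation of the conic. -/
lemma exists_sum_smul_eq_mul_linearForm {ι κ : Type*} [Fintype ι] [Fintype κ]
    (p : ι → Fin 3 → ℂ) (hcard : 8 ≤ Fintype.card ι + Fintype.card κ) {K : Poly3}
    (hK : K.IsHomogeneous 2) (hK0 : K ≠ 0) (hKp : ∀ i, eval (p i) K = 0) (D : κ → Poly3)
    (hD : ∀ k, (D k).IsHomogeneous 3) (hDp : ∀ k i, eval (p i) (D k) = 0)
    (hsep : ∀ i, ∃ G : Poly3, G.IsHomogeneous 3 ∧ eval (p i) G ≠ 0 ∧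
      ∀ j, j ≠ i → eval (p j) G = 0) :
    ∃ (c : κ → ℂ) (l : Fin 3 → ℂ), c ≠ 0 ∧ ∑ k, c k • D k = K * linearForm l := by
  classical
  have : FiniteDimensional ℂ (homogeneousSubmodule (Fin 3) ℂ 3) :=
    Module.Finite.iff_fg.2 (homogeneousSubmodule_fg (Fin 3) ℂ 3)
  let e : homogeneousSubmodule (Fin 3) ℂ 3 →ₗ[ℂ] (ι → ℂ) :=
    LinearMap.pi fun i => (aeval (p i)).toLinearMap ∘ₗ Submodule.subtype _
  have he : ∀ x i, e x i = eval (p i) x.1 := fun x i => by simp [e, aeval_eq_eval]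
  have hsurj : LinearMap.range e = ⊤ := by
    rw [eq_top_iff, ← (Pi.basisFun ℂ ι).span_eq, Submodule.span_le]
    rintro _ ⟨i, rfl⟩
    obtain ⟨G, hG, hGi, hGj⟩ := hsep i
    refine ⟨(eval (p i) G)⁻¹ • ⟨G, hG⟩, ?_⟩
    funext j
    rw [map_smul, Pi.smul_apply, he, Pi.basisFun_apply]
    rcases eq_or_ne j i with rfl | hji
    · simp [hGi]
    · simp [hGj j hji, hji]
  have hker := e.finrank_range_add_finrank_ker
  rw [hsurj, finrank_top, Module.finrank_fintype_fun_eq_card, finrank_homogeneousSubmodule] at hker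
  let φ : ((Fin 3 → ℂ) × (κ → ℂ)) →ₗ[ℂ] Poly3 :=
    LinearMap.coprod (LinearMap.mulLeft ℂ K ∘ₗ Fintype.linearCombination ℂ (X : Fin 3 → Poly3))
      (Fintype.linearCombination ℂ D)
  have hφ : ∀ l c, φ (l, c) = K * linearForm l + ∑ k, c k • D k := fun l c => by
    simp [φ, linearForm, Fintype.linearCombination_apply, Finset.mul_sum]
  have hφmem : ∀ x, φ x ∈ homogeneousSubmodule (Fin 3) ℂ 3 := fun ⟨l, c⟩ => by
    rw [hφ]
    exact add_mem (hK.mul (isHomogeneous_linearForm l))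
      (sum_mem fun k _ => Submodule.smul_mem _ _ (hD k))
  have hψmem : ∀ x, φ.codRestrict _ hφmem x ∈ LinearMap.ker e := fun ⟨l, c⟩ => by
    rw [LinearMap.mem_ker]
    funext i
    rw [he, LinearMap.codRestrict_apply, hφ]
    simp [hKp, hDp, smul_eval]
  let ψ : ((Fin 3 → ℂ) × (κ → ℂ)) →ₗ[ℂ] LinearMap.ker e :=
    (φ.codRestrict _ hφmem).codRestrict _ hψmem
  have hlt : Module.finrank ℂ (LinearMap.ker e) < Module.finrank ℂ ((Fin 3 → ℂ) × (κ → ℂ)) := by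
    have : (3 + 2).choose 2 = 10 := rfl
    rw [Module.finrank_prod, Module.finrank_fintype_fun_eq_card,
      Module.finrank_fintype_fun_eq_card, Fintype.card_fin]
    omega
  obtain ⟨⟨l, c⟩, hx, hx0⟩ := Submodule.exists_mem_ne_zero_of_ne_bot
    (LinearMap.ker_ne_bot_of_finrank_lt (K := ℂ) (V := (Fin 3 → ℂ) × (κ → ℂ))
      (V₂ := LinearMap.ker e) (f := ψ) hlt)
  have hzero : K * linearForm l + ∑ k, c k • D k = 0 := by
    rw [← hφ]
    exact congrArg (fun y : LinearMap.ker e => (y.1.1 : Poly3)) (LinearMap.mem_ker.1 hx)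
  refine ⟨c, -l, fun hc => hx0 ?_, ?_⟩
  · subst hc
    have hl : linearForm l = 0 := by simpa [hK0] using hzero
    rw [linearForm_eq_zero hl]
    rfl
  · have hneg : linearForm (-l) = -linearForm l := by simp [linearForm]
    rw [hneg, mul_neg]
    exact eq_neg_of_add_eq_zero_right hzero

open Matrix in
/-- Products of three lines separate the points of an irreducible conic, as soon as the points
other than a given one can be covered by three pairs. -/
lemma exists_cubic_separating {ι : Type*} {K : Poly3} (hK : K.IsHomogeneous 2)
    (hirr : Irreducible K) (p : ι → ProjPlane) (hp : Function.Injective p)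
    (hKp : ∀ i, VanishesAt K (p i)) (i : ι) (a b : Fin 3 → ι) (ha : ∀ k, a k ≠ i)
    (hb : ∀ k, b k ≠ i) (hab : ∀ k, a k ≠ b k) (hcov : ∀ j, j ≠ i → ∃ k, j = a k ∨ j = b k) :
    ∃ G : Poly3, G.IsHomogeneous 3 ∧ eval (p i).rep G ≠ 0 ∧
      ∀ j, j ≠ i → eval (p j).rep G = 0 := by
  refine ⟨∏ k, linearForm ((p (a k)).rep ⨯₃ (p (b k)).rep), ?_, ?_, fun j hj => ?_⟩
  · simpa using IsHomogeneous.prod Finset.univ _ (fun _ => 1)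
      fun k _ => isHomogeneous_linearForm ((p (a k)).rep ⨯₃ (p (b k)).rep)
  · rw [map_prod, Finset.prod_ne_zero_iff]
    intro k _
    rw [eval_linearForm]
    have hli : ∀ {m n}, m ≠ n → LinearIndependent ℂ ![(p m).rep, (p n).rep] := fun h =>
      Projectivization.linearIndependent_pair_iff_ne.2 (hp.ne h)
    exact triple_product_ne_zero_of_irreducible hK hirr (hli (hab k)) (hli (ha k)) (hli (hb k))
      (hKp _) (hKp _) (hKp _)
  · obtain ⟨k, hk⟩ := hcov j hj
    rw [map_prod]
    refine Finset.prod_eq_zero (Finset.mem_univ k) ?_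
    rw [eval_linearForm, dotProduct_comm]
    rcases hk with rfl | rfl <;> simp

/-- A cubic meeting an irreducible conic in seven distinct points contains the conic. -/
lemma dvd_cubic_of_seven_points {K : Poly3} (hK : K.IsHomogeneous 2) (hirr : Irreducible K)
    (p : Fin 7 → ProjPlane) (hp : Function.Injective p) (hKp : ∀ i, VanishesAt K (p i))
    {G : Poly3} (hG : G.IsHomogeneous 3) (hGp : ∀ i, VanishesAt G (p i)) : K ∣ G := by
  obtain ⟨c, l, hc, hcl⟩ := exists_sum_smul_eq_mul_linearForm (κ := Unit) (fun i => (p i).rep)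
    (by simp) hK hirr.ne_zero hKp (fun _ => G) (fun _ => hG) (fun _ => hGp) fun i =>
      exists_cubic_separating hK hirr p hp hKp i ![i + 1, i + 3, i + 5] ![i + 2, i + 4, i + 6]
        (by revert i; decide) (by revert i; decide) (by revert i; decide) (by revert i; decide)
  have hc0 : c () ≠ 0 := fun h => hc (funext fun _ => h)
  refine ⟨(c ())⁻¹ • linearForm l, ?_⟩
  rw [mul_smul_comm, ← hcl]
  simp [hc0]

/-- **The Pascal line for cubics.** If two cubics with no common nonconstant factor pass
through six distinct points on an irreducible conic and meet in exactly nine distinct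
points (the six given ones plus `P`, `Q`, `R`), then `P`, `Q`, `R` are collinear. -/
theorem pascal_line_for_cubics (A B C D E F : ProjPlane)
    (K : Poly3) (hKh : K.IsHomogeneous 2) (hKirr : Irreducible K)
    (honK : ∀ p ∈ [A, B, C, D, E, F], VanishesAt K p)
    (D₁ D₂ : Poly3) (h1 : D₁ ≠ 0) (h2 : D₂ ≠ 0)
    (h1h : D₁.IsHomogeneous 3) (h2h : D₂.IsHomogeneous 3)
    (hrel : IsRelPrime D₁ D₂)
    (hon1 : ∀ p ∈ [A, B, C, D, E, F], VanishesAt D₁ p)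
    (hon2 : ∀ p ∈ [A, B, C, D, E, F], VanishesAt D₂ p)
    (P Q R : ProjPlane)
    (hdist : ([A, B, C, D, E, F, P, Q, R] : List ProjPlane).Pairwise (· ≠ ·))
    (hzero : zeroSet D₁ ∩ zeroSet D₂ = {A, B, C, D, E, F, P, Q, R}) :
    Collin {P, Q, R} := by
  have hp : Function.Injective ![A, B, C, D, E, F] := by
    rw [← List.nodup_ofFn]
    exact (List.Pairwise.sublist (by simp) hdist : List.Nodup [A, B, C, D, E, F])
  have hlist : ∀ {G : Poly3}, (∀ p ∈ [A, B, C, D, E, F], VanishesAt G p) →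
      ∀ i, VanishesAt G (![A, B, C, D, E, F] i) := fun h i => by
    apply h
    fin_cases i <;> simp
  obtain ⟨c, l, hc, hcl⟩ := exists_sum_smul_eq_mul_linearForm
    (fun i => (![A, B, C, D, E, F] i).rep) (by simp) hKh hKirr.ne_zero (hlist honK) ![D₁, D₂]
    (by simp [Fin.forall_fin_two, h1h, h2h])
    (Fin.forall_fin_two.2 ⟨hlist hon1, hlist hon2⟩) fun i =>
      exists_cubic_separating hKh hKirr _ hp (hlist honK) i ![i + 1, i + 3, i + 5]
        ![i + 2, i + 4, i + 4]
        (by revert i; decide) (by revert i; decide) (by revert i; decide) (by revert i; decide)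
  simp only [Fin.sum_univ_two, Matrix.cons_val_zero, Matrix.cons_val_one] at hcl
  have hl : linearForm l ≠ 0 := by
    intro hl
    rw [hl, mul_zero] at hcl
    have hdvd : ∀ {s t : ℂ} {G H : Poly3}, s • G + t • H = 0 → s ≠ 0 → H ∣ G :=
      fun {s t G H} h hs => ⟨MvPolynomial.C (-(s⁻¹ * t)), by
        have h' : s • G = -(t • H) := eq_neg_of_add_eq_zero_left h
        rw [← inv_smul_smul₀ hs G, h', mul_comm, ← smul_eq_C_mul]
        module⟩
    apply hc
    funext i
    by_contra hi
    fin_cases i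
    · exact h2h.not_isUnit three_ne_zero (hrel (hdvd hcl hi) dvd_rfl)
    · exact h1h.not_isUnit three_ne_zero (hrel dvd_rfl (hdvd ((add_comm _ _).trans hcl) hi))
  refine ⟨linearForm l, hl, isHomogeneous_linearForm l, fun S hS => ?_⟩
  have hS12 : S ∈ zeroSet D₁ ∩ zeroSet D₂ := by
    rw [hzero]
    rcases hS with rfl | rfl | rfl <;> simp
  have hne : List.Nodup [S, A, B, C, D, E, F] := by
    rcases hS with rfl | rfl | rfl <;>
    · simp only [List.pairwise_cons, List.mem_cons, List.nodup_cons] at hdist ⊢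
      grind
  have hp7 : Function.Injective ![S, A, B, C, D, E, F] := by
    rw [← List.nodup_ofFn]
    exact hne
  have hKS : ¬ VanishesAt K S := by
    intro hKS
    have hdvd : ∀ {G : Poly3}, G.IsHomogeneous 3 → VanishesAt G S →
        (∀ p ∈ [A, B, C, D, E, F], VanishesAt G p) → K ∣ G := fun hG hGS hGp =>
      dvd_cubic_of_seven_points hKh hKirr _ hp7 (Fin.cons hKS (hlist honK)) hG
        (Fin.cons hGS (hlist hGp))
    exact hKirr.not_isUnit (hrel (hdvd h1h hS12.1 hon1) (hdvd h2h hS12.2 hon2))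
  have hev := congrArg (eval S.rep) hcl
  have e1 : eval S.rep D₁ = 0 := hS12.1
  have e2 : eval S.rep D₂ = 0 := hS12.2
  rw [map_add, smul_eval, smul_eval, e1, e2, mul_zero, mul_zero, add_zero, map_mul] at hev
  exact (mul_eq_zero.1 hev.symm).resolve_left hKS
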